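/- Let (a,b) ∈ W, let q₀,q₁ > 1, and suppose s > 0 is maximal with π_{q₀^s,q₁^s}(a) = π_{q₀^s,q₁^s}(b). Then for every t with 0 < t < s, one has max π_{q₀^t,q₁^t}([0]_{a,b}) ≥ min π_{q₀^t,q₁^t}([1]_{a,b}), and consequently π_{q₀^t,q₁^t}(Ω_{a,b}) = [0, 1/(q₁^t − 1)]. -/

import Mathlib

open Filter Topology

/-- The base corresponding to a digit: `q0` for digit `0` (`false`), `q1` for digit `1` (`true`). -/
noncomputable def qb (q0 q1 : ℝ) (d : Bool) : ℝ := if d then q1 else q0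

/-- `piE q0 q1 i = Σ_{k=1}^∞ i_k / (q_{i_1} ⋯ q_{i_k})`, with 0-based indexing. -/
noncomputable def piE (q0 q1 : ℝ) (i : ℕ → Bool) : ℝ :=
  ∑' k : ℕ, (if i k then (1 : ℝ) else 0) / ∏ j ∈ Finset.range (k + 1), qb q0 q1 (i j)

/-- Strict lexicographic order `≺` on binary sequences. -/
def lexLt (u v : ℕ → Bool) : Prop := ∃ n : ℕ, (∀ m, m < n → u m = v m) ∧ u n < v n

/-- Non-strict lexicographic order `⪯`. -/
def lexLe (u v : ℕ → Bool) : Prop := lexLt u v ∨ u = v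

/-- The tail `i_{n+1} i_{n+2} ⋯` of a sequence (0-based: drop the first `n` entries). -/
def shiftTail (i : ℕ → Bool) (n : ℕ) : ℕ → Bool := fun k => i (n + k)

/-- `Omega a b` : sequences none of whose tails lies in the open lexicographic interval `]a,b[`. -/
def Omega (a b : ℕ → Bool) : Set (ℕ → Bool) :=
  {i | ∀ n : ℕ, ¬ (lexLt a (shiftTail i n) ∧ lexLt (shiftTail i n) b)}

/-- `(a,b) ∈ W` : `a` starts with digit 0, `b` starts with digit 1, and `a, b ∈ Ω_{a,b}`. -/
def memW (a b : ℕ → Bool) : Prop :=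
  a 0 = false ∧ b 0 = true ∧ a ∈ Omega a b ∧ b ∈ Omega a b

/-- The set `L_{a,b,n}` of length-`n` prefixes of elements of `Ω_{a,b}`, as a finset. -/
noncomputable def Lwords (a b : ℕ → Bool) (n : ℕ) : Finset (Fin n → Bool) :=
  Set.Finite.toFinset
    (Set.toFinite {w : Fin n → Bool | ∃ i ∈ Omega a b, ∀ k : Fin n, i k.1 = w k})

/-- Topological entropy `h(Ω_{a,b}) = lim_{n→∞} (1/n) log #L_{a,b,n}`; the limit exists by
subadditivity, hence it coincides with the `limsup` used here. -/
noncomputable def entropy (a b : ℕ → Bool) : ℝ :=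
  Filter.limsup (fun n : ℕ => Real.log ((Lwords a b n).card) / n) Filter.atTop

/-- The cylinder `[d]_{a,b} = Ω_{a,b} ∩ d{0,1}^ℕ` of a single digit `d`. -/
def cyl (a b : ℕ → Bool) (d : Bool) : Set (ℕ → Bool) := {i | i ∈ Omega a b ∧ i 0 = d}


/-- The sequences differ: order them. -/
lemma lex_tri (u v : ℕ → Bool) (h : u ≠ v) : lexLt u v ∨ lexLt v u := by
  classical
  have hex : ∃ n, u n ≠ v n := by
    by_contra hc; push Not at hc; exact h (funext hc)
  have h1 := Nat.find_spec hex
  have h2 : ∀ m, m < Nat.find hex → u m = v m := fun m hm => by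
    have := Nat.find_min hex hm
    simpa using this
  rcases lt_or_gt_of_ne h1 with h3 | h3
  · exact Or.inl ⟨_, h2, h3⟩
  · exact Or.inr ⟨_, fun m hm => (h2 m hm).symm, h3⟩

lemma shiftTail_shiftTail (i : ℕ → Bool) (m n : ℕ) :
    shiftTail (shiftTail i m) n = shiftTail i (m + n) := by
  funext k; simp [shiftTail, add_assoc]

lemma shiftTail_mem {a b i : ℕ → Bool} (h : i ∈ Omega a b) (n : ℕ) : shiftTail i n ∈ Omega a b := by
  intro m
  rw [shiftTail_shiftTail]
  exact h _

lemma bool_lt {x y : Bool} (h : x < y) : x = false ∧ y = true := by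
  revert h; revert x y; decide

lemma lex_digit {u v : ℕ → Bool} (hu : u 0 = false) (hv : v 0 = true) : lexLt u v :=
  ⟨0, by simp, by rw [hu, hv]; decide⟩

lemma lexLt_trans {u v w : ℕ → Bool} (h1 : lexLt u v) (h2 : lexLt v w) : lexLt u w := by
  obtain ⟨n, hn, hn'⟩ := h1
  obtain ⟨m, hm, hm'⟩ := h2
  rcases lt_trichotomy n m with h | h | h
  · exact ⟨n, fun k hk => (hn k hk).trans (hm k (hk.trans h)), by rw [← hm n h]; exact hn'⟩
  · subst h
    exact ⟨n, fun k hk => (hn k hk).trans (hm k hk), hn'.trans hm'⟩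
  · exact ⟨m, fun k hk => (hn k (hk.trans h)).trans (hm k hk), by rw [hn m h]; exact hm'⟩

section base
variable {p q : ℝ}

lemma qb_ge (κ : ℝ) (hp : κ ≤ p) (hq : κ ≤ q) (d : Bool) : κ ≤ qb p q d := by
  unfold qb; split_ifs <;> assumption

lemma qb_pos (hp : 1 < p) (hq : 1 < q) (d : Bool) : 0 < qb p q d :=
  lt_of_lt_of_le one_pos (qb_ge 1 hp.le hq.le d)

lemma prod_ge (hp : 1 < p) (hq : 1 < q) (i : ℕ → Bool) (n : ℕ) :
    (min p q) ^ n ≤ ∏ j ∈ Finset.range n, qb p q (i j) := by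
  have h1 : (1 : ℝ) < min p q := lt_min hp hq
  calc (min p q) ^ n = ∏ j ∈ Finset.range n, (min p q) := by simp
    _ ≤ _ := Finset.prod_le_prod (fun _ _ => by linarith)
      (fun j _ => qb_ge _ (min_le_left _ _) (min_le_right _ _) _)

lemma prod_pos' (hp : 1 < p) (hq : 1 < q) (i : ℕ → Bool) (n : ℕ) :
    0 < ∏ j ∈ Finset.range n, qb p q (i j) :=
  Finset.prod_pos (fun _ _ => qb_pos hp hq _)

lemma prod_ge_one (hp : 1 < p) (hq : 1 < q) (i : ℕ → Bool) (n : ℕ) :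
    1 ≤ ∏ j ∈ Finset.range n, qb p q (i j) :=
  (one_le_pow₀ (lt_min hp hq).le).trans (prod_ge hp hq i n)

/-- The general term. -/
noncomputable def term (p q : ℝ) (i : ℕ → Bool) (k : ℕ) : ℝ :=
  (if i k then (1 : ℝ) else 0) / ∏ j ∈ Finset.range (k + 1), qb p q (i j)

lemma term_nonneg (hp : 1 < p) (hq : 1 < q) (i : ℕ → Bool) (k : ℕ) : 0 ≤ term p q i k := by
  unfold term
  apply div_nonneg
  · split_ifs <;> norm_num
  · exact (prod_pos' hp hq i _).le

lemma term_le (hp : 1 < p) (hq : 1 < q) (i : ℕ → Bool) (k : ℕ) :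
    term p q i k ≤ ((min p q)⁻¹) ^ k := by
  have h1 : (1 : ℝ) < min p q := lt_min hp hq
  unfold term
  rw [inv_pow, ← one_div]
  apply div_le_div₀ zero_le_one
  · split_ifs <;> norm_num
  · positivity
  · exact (pow_le_pow_right₀ h1.le (Nat.le_succ k)).trans (prod_ge hp hq i _)

lemma geo_summable (hp : 1 < p) (hq : 1 < q) : Summable (fun k : ℕ => ((min p q)⁻¹) ^ k) := by
  have h1 : (1 : ℝ) < min p q := lt_min hp hq
  exact summable_geometric_of_lt_one (by positivity) (inv_lt_one_of_one_lt₀ h1)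

lemma term_summable (hp : 1 < p) (hq : 1 < q) (i : ℕ → Bool) : Summable (term p q i) :=
  Summable.of_nonneg_of_le (term_nonneg hp hq i) (term_le hp hq i) (geo_summable hp hq)

lemma term_succ (i : ℕ → Bool) (k : ℕ) :
    term p q i (k + 1) = term p q (shiftTail i 1) k / qb p q (i 0) := by
  unfold term
  rw [Finset.prod_range_succ' _ (k + 1), ← div_div]
  simp only [shiftTail, add_comm 1]

lemma piE_cons (hp : 1 < p) (hq : 1 < q) (i : ℕ → Bool) :
    piE p q i = ((if i 0 then (1 : ℝ) else 0) + piE p q (shiftTail i 1)) / qb p q (i 0) := by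
  have h : piE p q i = ∑' k, term p q i k := rfl
  rw [h, (term_summable hp hq i).tsum_eq_zero_add]
  simp_rw [term_succ]
  rw [tsum_div_const, add_div]
  congr 1
  simp [term]

lemma piE_nonneg (hp : 1 < p) (hq : 1 < q) (i : ℕ → Bool) : 0 ≤ piE p q i :=
  tsum_nonneg (term_nonneg hp hq i)

lemma piE_le (hp : 1 < p) (hq : 1 < q) (i : ℕ → Bool) : piE p q i ≤ 1 / (q - 1) := by
  have h : piE p q i = ∑' k, term p q i k := rfl
  have hB : 0 < 1 / (q - 1) := by apply one_div_pos.2; linarith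
  rw [h]
  apply Real.tsum_le_of_sum_range_le (term_nonneg hp hq i)
  intro n
  induction n generalizing i with
  | zero => simpa using hq.le
  | succ n ih =>
    rw [Finset.sum_range_succ']
    simp_rw [term_succ]
    rw [← Finset.sum_div]
    have h2 := ih (shiftTail i 1) rfl
    have h3 : term p q i 0 = (if i 0 then (1 : ℝ) else 0) / qb p q (i 0) := by simp [term]
    rw [h3, ← add_div, div_le_iff₀ (qb_pos hp hq _)]
    have h4 : 1 / (q - 1) * q = 1 / (q - 1) + 1 := by
      have : q - 1 ≠ 0 := by linarith
      field_simp; ring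
    cases hi : i 0
    · simp [qb]
      have hB' : 0 < (q - 1)⁻¹ := by simpa using hq
      simp at h2
      nlinarith
    · simp only [qb, if_true]
      linarith

lemma piE_prefix (hp : 1 < p) (hq : 1 < q) (u v : ℕ → Bool) (n : ℕ) (h : ∀ m, m < n → u m = v m) :
    piE p q (shiftTail u n) - piE p q (shiftTail v n) =
      (∏ j ∈ Finset.range n, qb p q (u j)) * (piE p q u - piE p q v) := by
  induction n with
  | zero =>
    have : ∀ w, shiftTail w 0 = w := fun w => by funext k; simp [shiftTail]
    simp [this]
  | succ n ih =>
    have h1 := ih (fun m hm => h m (by omega))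
    rw [piE_cons hp hq (shiftTail u n), piE_cons hp hq (shiftTail v n), shiftTail_shiftTail,
      shiftTail_shiftTail] at h1
    have h2 : shiftTail u n 0 = u n := by simp [shiftTail]
    have h3 : shiftTail v n 0 = u n := by simp [shiftTail, h n (by omega)]
    rw [h2, h3, ← sub_div, div_eq_iff (qb_pos hp hq _).ne'] at h1
    rw [Finset.prod_range_succ]
    linarith

lemma piE_continuous (hp : 1 < p) (hq : 1 < q) : Continuous (piE p q) := by
  have : piE p q = fun i => ∑' k, term p q i k := rfl
  rw [this]
  apply continuous_tsum (u := fun k => ((min p q)⁻¹) ^ k) _ (geo_summable hp hq)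
  · intro k i
    rw [Real.norm_of_nonneg (term_nonneg hp hq i k)]
    exact term_le hp hq i k
  · intro k
    unfold term
    apply Continuous.div
    · exact (continuous_of_discreteTopology (f := fun d : Bool => if d then (1 : ℝ) else 0)).comp
        (continuous_apply k)
    · apply continuous_finsetProd
      intro j _
      exact (continuous_of_discreteTopology (f := qb p q)).comp (continuous_apply j)
    · intro i
      exact (prod_pos' hp hq i _).ne'

end base

lemma lex_open_right (a : ℕ → Bool) : IsOpen {i | lexLt a i} := by
  have : {i | lexLt a i} = ⋃ n : ℕ, ((⋂ m ∈ Finset.range n, {i : ℕ → Bool | a m = i m}) ∩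
      {i | a n < i n}) := by
    ext i; simp [lexLt]
  rw [this]
  apply isOpen_iUnion; intro n
  apply IsOpen.inter
  · apply isOpen_biInter_finset; intro m _
    exact (isOpen_discrete {d : Bool | a m = d}).preimage
      (continuous_apply m : Continuous fun i : ℕ → Bool => i m)
  · exact (isOpen_discrete {d : Bool | a n < d}).preimage
      (continuous_apply n : Continuous fun i : ℕ → Bool => i n)

lemma lex_open_left (a : ℕ → Bool) : IsOpen {i | lexLt i a} := by
  have : {i | lexLt i a} = ⋃ n : ℕ, ((⋂ m ∈ Finset.range n, {i : ℕ → Bool | i m = a m}) ∩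
      {i | i n < a n}) := by
    ext i; simp [lexLt]
  rw [this]
  apply isOpen_iUnion; intro n
  apply IsOpen.inter
  · apply isOpen_biInter_finset; intro m _
    exact (isOpen_discrete {d : Bool | d = a m}).preimage
      (continuous_apply m : Continuous fun i : ℕ → Bool => i m)
  · exact (isOpen_discrete {d : Bool | d < a n}).preimage
      (continuous_apply n : Continuous fun i : ℕ → Bool => i n)

lemma Omega_closed (a b : ℕ → Bool) : IsClosed (Omega a b) := by
  have : Omega a b = ⋂ n : ℕ, (fun i => shiftTail i n) ⁻¹' ({i | lexLt a i} ∩ {i | lexLt i b})ᶜ := by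
    ext i; simp [Omega]
  rw [this]
  apply isClosed_iInter; intro n
  apply IsClosed.preimage
  · unfold shiftTail; fun_prop
  · exact ((lex_open_right a).inter (lex_open_left b)).isClosed_compl

lemma cyl_compact (a b : ℕ → Bool) (d : Bool) : IsCompact (cyl a b d) := by
  have : cyl a b d = Omega a b ∩ (fun i => i 0) ⁻¹' {d} := by ext i; simp [cyl]
  rw [this]
  exact ((Omega_closed a b).inter ((isClosed_discrete _).preimage (continuous_apply 0))).isCompact

/-- The expanding map with threshold `x`. -/
noncomputable def Tm (p q x y : ℝ) : ℝ := if x ≤ y then q * y - 1 else p * y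

open Classical in
/-- Itinerary of `y`. -/
noncomputable def itin (p q x y : ℝ) : ℕ → Bool := fun n => decide (x ≤ (Tm p q x)^[n] y)

lemma itin_shift (p q x y : ℝ) (n : ℕ) :
    shiftTail (itin p q x y) n = itin p q x ((Tm p q x)^[n] y) := by
  funext k
  simp only [shiftTail, itin, ← Function.iterate_add_apply, add_comm n k]

section full
variable {p q : ℝ}

lemma Tm_mem (hp : 1 < p) (hq : 1 < q) {x : ℝ} (h1 : 1 / q ≤ x) (h2 : p * x ≤ 1 / (q - 1)) {y : ℝ}
    (hy : y ∈ Set.Icc 0 (1 / (q - 1))) : Tm p q x y ∈ Set.Icc 0 (1 / (q - 1)) := by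
  have h4 : 1 / (q - 1) * q = 1 / (q - 1) + 1 := by
    have : q - 1 ≠ 0 := by linarith
    field_simp; ring
  obtain ⟨ha, hb⟩ := hy
  unfold Tm
  split_ifs with h
  · have : 1 ≤ y * q := by rw [← div_le_iff₀ (by linarith)]; linarith
    constructor
    · linarith
    · nlinarith
  · push Not at h
    constructor
    · positivity
    · nlinarith

lemma Tm_iter_mem (hp : 1 < p) (hq : 1 < q) {x : ℝ} (h1 : 1 / q ≤ x) (h2 : p * x ≤ 1 / (q - 1))
    {y : ℝ} (hy : y ∈ Set.Icc 0 (1 / (q - 1))) (n : ℕ) :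
    (Tm p q x)^[n] y ∈ Set.Icc 0 (1 / (q - 1)) := by
  induction n with
  | zero => simpa using hy
  | succ n ih =>
    rw [Function.iterate_succ_apply']
    exact Tm_mem hp hq h1 h2 ih

lemma piE_itin (hp : 1 < p) (hq : 1 < q) {x : ℝ} (h1 : 1 / q ≤ x) (h2 : p * x ≤ 1 / (q - 1)) {y : ℝ}
    (hy : y ∈ Set.Icc 0 (1 / (q - 1))) : piE p q (itin p q x y) = y := by
  set B := 1 / (q - 1) with hB
  have key : ∀ n : ℕ, ∀ y ∈ Set.Icc 0 B,
      |y - piE p q (itin p q x y)| ≤ B * ((min p q)⁻¹) ^ n := by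
    intro n
    induction n with
    | zero =>
      intro y hy
      have h3 := piE_nonneg hp hq (itin p q x y)
      have h4 := piE_le hp hq (itin p q x y)
      obtain ⟨h5, h6⟩ := hy
      rw [abs_le]; constructor <;> simp <;> linarith
    | succ n ih =>
      intro y hy
      have h3 := ih _ (Tm_mem hp hq h1 h2 hy)
      have h5 := itin_shift p q x y 1
      simp only [Function.iterate_one] at h5
      have h6 : y - piE p q (itin p q x y) =
          (Tm p q x y - piE p q (itin p q x (Tm p q x y))) / qb p q (itin p q x y 0) := by
        rw [piE_cons hp hq, h5]
        by_cases h : x ≤ y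
        · simp [itin, h, Tm, qb]; field_simp; ring
        · simp [itin, h, Tm, qb]; field_simp
      have hm : (1 : ℝ) < min p q := lt_min hp hq
      have h7 : min p q ≤ qb p q (itin p q x y 0) :=
        qb_ge _ (min_le_left _ _) (min_le_right _ _) _
      rw [h6, abs_div, abs_of_pos (qb_pos hp hq _), pow_succ, ← mul_assoc, ← div_eq_mul_inv]
      exact div_le_div₀ ((abs_nonneg _).trans h3) h3 (by linarith) h7
  have hm : (1 : ℝ) < min p q := lt_min hp hq
  have hlim : Tendsto (fun n : ℕ => B * ((min p q)⁻¹) ^ n) atTop (𝓝 (B * 0)) :=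
    (tendsto_pow_atTop_nhds_zero_of_lt_one (by positivity) (inv_lt_one_of_one_lt₀ hm)).const_mul B
  have := ge_of_tendsto' hlim (fun n => key n y hy)
  rw [mul_zero] at this
  have := abs_nonpos_iff.1 this
  linarith

lemma full_image (hp : 1 < p) (hq : 1 < q) (a b : ℕ → Bool) (hW : memW a b)
    (h : sInf (piE p q '' cyl a b true) ≤ sSup (piE p q '' cyl a b false)) :
    piE p q '' Omega a b = Set.Icc 0 (1 / (q - 1)) := by
  obtain ⟨ha0, hb0, haO, hbO⟩ := hW
  have hc0 := (cyl_compact a b false).image (piE_continuous hp hq)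
  have hc1 := (cyl_compact a b true).image (piE_continuous hp hq)
  obtain ⟨α, hα, hαs⟩ := hc0.sSup_mem ⟨_, a, ⟨haO, ha0⟩, rfl⟩
  obtain ⟨β, hβ, hβs⟩ := hc1.sInf_mem ⟨_, b, ⟨hbO, hb0⟩, rfl⟩
  have hmax : ∀ u ∈ cyl a b false, piE p q u ≤ piE p q α := fun u hu => by
    rw [hαs]; exact le_csSup hc0.bddAbove ⟨u, hu, rfl⟩
  have hmin : ∀ u ∈ cyl a b true, piE p q β ≤ piE p q u := fun u hu => by
    rw [hβs]; exact csInf_le hc1.bddBelow ⟨u, hu, rfl⟩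
  rw [← hαs, ← hβs] at h
  clear hαs hβs hc0 hc1
  set x := piE p q β with hx
  have h1 : 1 / q ≤ x := by
    rw [hx, piE_cons hp hq β, hβ.2]
    have := piE_nonneg hp hq (shiftTail β 1)
    simp only [qb, if_true]
    gcongr
    linarith
  have h2 : p * x ≤ 1 / (q - 1) := by
    have h3 := piE_cons hp hq α
    have h4 := piE_le hp hq (shiftTail α 1)
    rw [hα.2] at h3
    simp only [qb] at h3
    rw [eq_div_iff (by simp; linarith)] at h3
    simp at h3 h4 ⊢
    nlinarith
  apply Set.Subset.antisymm
  · rintro _ ⟨i, _, rfl⟩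
    exact ⟨piE_nonneg hp hq i, piE_le hp hq i⟩
  intro y hy
  refine ⟨itin p q x y, ?_, piE_itin hp hq h1 h2 hy⟩
  intro n
  rw [itin_shift]
  have hz := Tm_iter_mem hp hq h1 h2 hy n
  set z := (Tm p q x)^[n] y
  clear_value z
  rintro ⟨hl, hr⟩
  by_cases hzx : x ≤ z
  · -- starts with 1
    have hlt : lexLt (itin p q x z) β := by
      by_cases e : b = β
      · rwa [← e]
      rcases lex_tri b β e with h3 | h3
      · exact lexLt_trans hr h3
      · exfalso
        apply hβ.1 0
        have : shiftTail β 0 = β := by funext k; simp [shiftTail]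
        rw [this]
        exact ⟨lex_digit ha0 hβ.2, h3⟩
    obtain ⟨m, hm, hm'⟩ := hlt
    obtain ⟨e1, e2⟩ := bool_lt hm'
    have h5 := piE_prefix hp hq _ _ m hm
    rw [itin_shift, piE_itin hp hq h1 h2 hz, piE_itin hp hq h1 h2 (Tm_iter_mem hp hq h1 h2 hz m)]
      at h5
    have h6 := prod_ge_one hp hq (itin p q x z) m
    have h7 : (Tm p q x)^[m] z < x := by simpa [itin] using e1
    have h8 := hmin (shiftTail β m) ⟨shiftTail_mem hβ.1 m, by simpa [shiftTail] using e2⟩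
    nlinarith
  · push Not at hzx
    have hlt : lexLt α (itin p q x z) := by
      by_cases e : α = a
      · rwa [e]
      rcases lex_tri α a e with h3 | h3
      · exact lexLt_trans h3 hl
      · exfalso
        apply hα.1 0
        have : shiftTail α 0 = α := by funext k; simp [shiftTail]
        rw [this]
        exact ⟨h3, lex_digit hα.2 hb0⟩
    obtain ⟨m, hm, hm'⟩ := hlt
    obtain ⟨e1, e2⟩ := bool_lt hm'
    have h5 := piE_prefix hp hq _ _ m hm
    rw [itin_shift, piE_itin hp hq h1 h2 hz, piE_itin hp hq h1 h2 (Tm_iter_mem hp hq h1 h2 hz m)]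
      at h5
    have h6 := prod_ge_one hp hq α m
    have h7 : x ≤ (Tm p q x)^[m] z := by simpa [itin] using e2
    have h8 := hmax (shiftTail α m) ⟨shiftTail_mem hα.1 m, by simpa [shiftTail] using e1⟩
    nlinarith

end full

lemma prod_rpow' {q0 q1 : ℝ} (hq0 : 1 < q0) (hq1 : 1 < q1) {t s : ℝ} (ht : 0 < t) (u : ℕ → Bool)
    (n : ℕ) : ∏ j ∈ Finset.range n, qb (q0 ^ s) (q1 ^ s) (u j) =
      (∏ j ∈ Finset.range n, qb (q0 ^ t) (q1 ^ t) (u j)) ^ (s / t) := by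
  have hp := Real.one_lt_rpow hq0 ht
  have hq := Real.one_lt_rpow hq1 ht
  rw [← Real.finsetProd_rpow _ _ (fun j _ => (qb_pos hp hq _).le)]
  apply Finset.prod_congr rfl
  intro j _
  unfold qb
  have e : t * (s / t) = s := by field_simp
  split_ifs
  · rw [← Real.rpow_mul (by linarith), e]
  · rw [← Real.rpow_mul (by linarith), e]

/-- Lemma 2.5: let `(a,b) ∈ W`, `q₀,q₁ > 1`, and let `s > 0` be maximal with
`π_{q₀^s,q₁^s}(a) = π_{q₀^s,q₁^s}(b)`. Then for every `0 < t < s`, one has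
`max π_{q₀^t,q₁^t}([0]_{a,b}) ≥ min π_{q₀^t,q₁^t}([1]_{a,b})`, and hence
`π_{q₀^t,q₁^t}(Ω_{a,b}) = [0, 1/(q₁^t − 1)]`. -/
theorem stmt15 (a b : ℕ → Bool) (q0 q1 s : ℝ) (hW : memW a b) (hq0 : 1 < q0) (hq1 : 1 < q1)
    (hs : 0 < s) (heq : piE (q0 ^ s) (q1 ^ s) a = piE (q0 ^ s) (q1 ^ s) b)
    (hmax : ∀ t : ℝ, s < t → piE (q0 ^ t) (q1 ^ t) a ≠ piE (q0 ^ t) (q1 ^ t) b)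
    (t : ℝ) (ht0 : 0 < t) (hts : t < s) :
    sInf (piE (q0 ^ t) (q1 ^ t) '' cyl a b true) ≤
      sSup (piE (q0 ^ t) (q1 ^ t) '' cyl a b false) ∧
    piE (q0 ^ t) (q1 ^ t) '' Omega a b = Set.Icc 0 (1 / (q1 ^ t - 1)) := by 
  have hpt := Real.one_lt_rpow hq0 ht0
  have hqt := Real.one_lt_rpow hq1 ht0
  have hps := Real.one_lt_rpow hq0 hs
  have hqs := Real.one_lt_rpow hq1 hs
  have main : sInf (piE (q0 ^ t) (q1 ^ t) '' cyl a b true) ≤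
      sSup (piE (q0 ^ t) (q1 ^ t) '' cyl a b false) := by
    by_contra hcon
    push Not at hcon
    have hc0 := (cyl_compact a b false).image (piE_continuous hpt hqt)
    have hc1 := (cyl_compact a b true).image (piE_continuous hpt hqt)
    set δ := sInf (piE (q0 ^ t) (q1 ^ t) '' cyl a b true) -
      sSup (piE (q0 ^ t) (q1 ^ t) '' cyl a b false) with hδ
    have hδ0 : 0 < δ := by linarith
    have hgap : ∀ u v, u ∈ cyl a b false → v ∈ cyl a b true →
        δ ≤ piE (q0 ^ t) (q1 ^ t) v - piE (q0 ^ t) (q1 ^ t) u := by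
      intro u v hu hv
      have e1 := le_csSup hc0.bddAbove ⟨u, hu, rfl⟩
      have e2 := csInf_le hc1.bddBelow ⟨v, hv, rfl⟩
      linarith
    -- the image at `s` is full
    have hfull : piE (q0 ^ s) (q1 ^ s) '' Omega a b = Set.Icc 0 (1 / (q1 ^ s - 1)) := by
      apply full_image hps hqs a b hW
      have hd0 := (cyl_compact a b false).image (piE_continuous hps hqs)
      have hd1 := (cyl_compact a b true).image (piE_continuous hps hqs)
      obtain ⟨ha0, hb0, haO, hbO⟩ := hW
      have e1 := le_csSup hd0.bddAbove ⟨a, ⟨haO, ha0⟩, rfl⟩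
      have e2 := csInf_le hd1.bddBelow ⟨b, ⟨hbO, hb0⟩, rfl⟩
      linarith
    set r := s / t with hr
    have hr1 : 1 < r := by rw [hr, lt_div_iff₀ ht0]; linarith
    set C := 1 / (q1 ^ s - 1) with hC
    have hCpos : 0 < C := by apply one_div_pos.2; linarith
    have hlex : ∀ u v, u ∈ Omega a b → v ∈ Omega a b → lexLt u v →
        0 < piE (q0 ^ t) (q1 ^ t) v - piE (q0 ^ t) (q1 ^ t) u ∧
        |piE (q0 ^ s) (q1 ^ s) v - piE (q0 ^ s) (q1 ^ s) u| ≤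
          C / δ ^ r * (piE (q0 ^ t) (q1 ^ t) v - piE (q0 ^ t) (q1 ^ t) u) ^ r := by
      rintro u v hu hv ⟨n, hn, hn'⟩
      obtain ⟨e1, e2⟩ := bool_lt hn'
      have g := hgap (shiftTail u n) (shiftTail v n)
        ⟨shiftTail_mem hu n, by simpa [shiftTail] using e1⟩
        ⟨shiftTail_mem hv n, by simpa [shiftTail] using e2⟩
      have h1 := piE_prefix hpt hqt u v n hn
      have h2 := piE_prefix hps hqs u v n hn
      rw [prod_rpow' hq0 hq1 (s := s) ht0, ← hr] at h2
      have hP := prod_pos' hpt hqt u n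
      set P := ∏ j ∈ Finset.range n, qb (q0 ^ t) (q1 ^ t) (u j)
      set d := piE (q0 ^ t) (q1 ^ t) v - piE (q0 ^ t) (q1 ^ t) u with hd
      have h3 : δ ≤ P * d := by rw [hd]; linarith
      have hd0 : 0 < d := by
        by_contra hneg
        push Not at hneg
        nlinarith
      refine ⟨hd0, ?_⟩
      have h4 : δ ^ r ≤ P ^ r * d ^ r := by
        rw [← Real.mul_rpow hP.le hd0.le]
        exact Real.rpow_le_rpow hδ0.le h3 (by linarith)
      have hδr : 0 < δ ^ r := Real.rpow_pos_of_pos hδ0 _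
      have hPr : 0 < P ^ r := Real.rpow_pos_of_pos hP _
      have h5 : P ^ r * |piE (q0 ^ s) (q1 ^ s) v - piE (q0 ^ s) (q1 ^ s) u| ≤ C := by
        rw [← abs_of_pos hPr, ← abs_mul, abs_le]
        have b1 := piE_nonneg hps hqs (shiftTail u n)
        have b2 := piE_le hps hqs (shiftTail u n)
        have b3 := piE_nonneg hps hqs (shiftTail v n)
        have b4 := piE_le hps hqs (shiftTail v n)
        constructor <;> linarith
      rw [div_mul_eq_mul_div, le_div_iff₀ hδr]
      calc _ ≤ |piE (q0 ^ s) (q1 ^ s) v - piE (q0 ^ s) (q1 ^ s) u| * (P ^ r * d ^ r) := by gcongr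
        _ = (P ^ r * |piE (q0 ^ s) (q1 ^ s) v - piE (q0 ^ s) (q1 ^ s) u|) * d ^ r := by ring
        _ ≤ C * d ^ r := by
          have := Real.rpow_pos_of_pos hd0 r
          gcongr
    have habs : ∀ u v, u ∈ Omega a b → v ∈ Omega a b →
        |piE (q0 ^ s) (q1 ^ s) u - piE (q0 ^ s) (q1 ^ s) v| ≤
          C / δ ^ r * |piE (q0 ^ t) (q1 ^ t) u - piE (q0 ^ t) (q1 ^ t) v| ^ r := by
      intro u v hu hv
      by_cases e : u = v
      · subst e
        simp [Real.zero_rpow (by linarith : r ≠ 0)]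
      rcases lex_tri u v e with h1 | h1
      · obtain ⟨h2, h3⟩ := hlex u v hu hv h1
        rw [abs_sub_comm, abs_sub_comm (piE (q0 ^ t) (q1 ^ t) u), abs_of_pos h2]
        exact h3
      · obtain ⟨h2, h3⟩ := hlex v u hv hu h1
        rw [abs_of_pos h2]
        exact h3
    have hinj : Set.InjOn (piE (q0 ^ t) (q1 ^ t)) (Omega a b) := by
      intro u hu v hv huv
      by_contra e
      rcases lex_tri u v e with h1 | h1
      · have := (hlex u v hu hv h1).1
        linarith
      · have := (hlex v u hv hu h1).1
        linarith
    let g : ℝ → (ℕ → Bool) := Function.invFunOn (piE (q0 ^ t) (q1 ^ t)) (Omega a b)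
    have hg : ∀ u ∈ Omega a b, g (piE (q0 ^ t) (q1 ^ t) u) = u := fun u hu =>
      hinj.leftInvOn_invFunOn hu
    let f : ℝ → ℝ := fun z => piE (q0 ^ s) (q1 ^ s) (g z)
    have hC' : 0 ≤ C / δ ^ r := by have := Real.rpow_pos_of_pos hδ0 r; positivity
    have hr0 : 0 ≤ r := by linarith
    have hH : HolderOnWith ⟨C / δ ^ r, hC'⟩ ⟨r, hr0⟩ f (piE (q0 ^ t) (q1 ^ t) '' Omega a b) := by
      rintro _ ⟨u, hu, rfl⟩ _ ⟨v, hv, rfl⟩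
      have h1 := habs u v hu hv
      simp only [f, hg u hu, hg v hv]
      rw [edist_dist, edist_dist, Real.dist_eq, Real.dist_eq]
      have e1 : ENNReal.ofNNReal ⟨C / δ ^ r, hC'⟩ = ENNReal.ofReal (C / δ ^ r) :=
        (ENNReal.ofReal_eq_coe_nnreal hC').symm
      rw [e1]
      change _ ≤ _ * (ENNReal.ofReal |piE (q0 ^ t) (q1 ^ t) u - piE (q0 ^ t) (q1 ^ t) v|) ^ r
      rw [ENNReal.ofReal_rpow_of_nonneg (abs_nonneg _) hr0, ← ENNReal.ofReal_mul hC']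
      exact ENNReal.ofReal_le_ofReal h1
    have him : f '' (piE (q0 ^ t) (q1 ^ t) '' Omega a b) = Set.Icc 0 C := by
      rw [← hfull, Set.image_image]
      apply Set.image_congr
      intro u hu
      simp only [f, hg u hu]
    have hdim := hH.dimH_image_le (by change (0 : ℝ) < r; linarith)
    rw [him, Real.dimH_of_nonempty_interior (by rw [interior_Icc]; exact Set.nonempty_Ioo.2 hCpos)]
      at hdim
    have hle : dimH (piE (q0 ^ t) (q1 ^ t) '' Omega a b) ≤ 1 := by
      refine (dimH_mono (Set.subset_univ _)).trans ?_
      rw [Real.dimH_univ]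
    have hrt : ENNReal.ofNNReal ⟨r, hr0⟩ = ENNReal.ofReal r :=
      (ENNReal.ofReal_eq_coe_nnreal hr0).symm
    rw [hrt] at hdim
    have hlt : (1 : ENNReal) / ENNReal.ofReal r < 1 := by
      apply ENNReal.div_lt_of_lt_mul
      rw [one_mul, ENNReal.one_lt_ofReal]
      exact hr1
    have h9 : dimH (piE (q0 ^ t) (q1 ^ t) '' Omega a b) / ENNReal.ofReal r ≤
        1 / ENNReal.ofReal r := by gcongr
    have h10 := hdim.trans_lt (h9.trans_lt hlt)
    simp at h10
  exact ⟨main, full_image hpt hqt a b hW main⟩
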